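/- Let d ≥ 3, f ∈ 𝒮(ℝ^d; ℂ) and ξ₀ ∈ ℝ^d \ {0}. The limit differential equation (d/dt) ξ^(0)(t) = F^(0)(ξ^(0)(t)), ξ^(0)(0) = ξ₀, admits a unique maximal solution ξ^(0) ∈ C¹([0, T_max); ℝ^d) with values in ℝ^d \ {0} and T_max > 0. -/

import Mathlib

open MeasureTheory Filter Set
open scoped RealInnerProductSpace Topology ENNReal

noncomputable section

abbrev E (d : ℕ) := EuclideanSpace ℝ (Fin d)

/-- `g(η) = η |f(η)|²`. -/
def gfun {d : ℕ} (f : SchwartzMap (E d) ℂ) (η : E d) : E d := ‖f η‖ ^ 2 • η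

/-- the average `⨍_a^b u(σ) dσ`. -/
def intAvg {d : ℕ} (u : ℝ → E d) (a b : ℝ) : E d := (b - a)⁻¹ • ∫ σ in a..b, u σ

/-- `𝓕^(h)(u)(t)`; since `g` is real-valued, taking the real part of the complex
integral amounts to replacing `e^{-irθ}` by `cos (rθ)`. -/
def calF {d : ℕ} (f : SchwartzMap (E d) ℂ) (h : ℝ) (u : ℝ → E d) (t : ℝ) : E d :=
  (-2 : ℝ) • ∫ η, (∫ r in (0:ℝ)..(t / h),
    Real.cos (r * (‖η‖ ^ 2 - 2 * ⟪η, intAvg u (t - h * r) t⟫))) • gfun f η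

/-- the `i`-th component of the Fourier transform `ĝ(x) = (2π)^{-d/2} ∫ e^{-ix·η} g(η) dη`. -/
def ftGi {d : ℕ} (f : SchwartzMap (E d) ℂ) (i : Fin d) (x : E d) : ℂ :=
  ((2 * Real.pi) ^ (-(d : ℝ) / 2) : ℝ) *
    ∫ η, Complex.exp (-Complex.I * (⟪x, η⟫ : ℝ)) * ((gfun f η i : ℝ) : ℂ)

/-- `‖g‖_{L¹}`. -/
def L1g {d : ℕ} (f : SchwartzMap (E d) ℂ) : ℝ := ∫ η, ‖gfun f η‖

/-- `‖ĝ‖_{L¹}` (with the euclidean norm of the complex vector `ĝ(x)`). -/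
def L1ftg {d : ℕ} (f : SchwartzMap (E d) ℂ) : ℝ :=
  ∫ x, Real.sqrt (∑ i, ‖ftGi f i x‖ ^ 2)

/-- `C_g^1 = ‖g‖_{L¹} + (d/2 − 1) π^{d/2} ‖ĝ‖_{L¹}`. -/
def Cg1 {d : ℕ} (f : SchwartzMap (E d) ℂ) : ℝ :=
  L1g f + ((d : ℝ) / 2 - 1) * Real.pi ^ ((d : ℝ) / 2) * L1ftg f

/-- the inner integral `∫_{ℝ^d} e^{-ir(|η|²-2η·u)} g(η) dη` (the real part being taken
componentwise, `e^{-irθ}` contributes `cos (rθ)` since `g` is real). -/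
def F0inner {d : ℕ} (f : SchwartzMap (E d) ℂ) (r : ℝ) (u : E d) : E d :=
  ∫ η, Real.cos (r * (‖η‖ ^ 2 - 2 * ⟪η, u⟫)) • gfun f η

/-- `F^(0)(u) = −2 Re ∫_0^∞ (∫ e^{−ir(|η|²−2η·u)} η |f(η)|² dη) dr`, as the improper
integral in `r` (i.e. the limit of the integrals over `[0,R]` as `R → ∞`). -/
def F0pt {d : ℕ} (f : SchwartzMap (E d) ℂ) (u : E d) : E d :=
  limUnder atTop fun R : ℝ => ∫ r in (0:ℝ)..R, (-2 : ℝ) • F0inner f r u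

/-- The Riemann-Lebesgue lemma for sine transforms of real-valued functions. -/
lemma tendsto_integral_sin_mul {K : ℝ → ℝ} (hK : Integrable K) :
    Tendsto (fun R : ℝ => ∫ x, Real.sin (R * x) * K x) atTop (𝓝 0) := by
  have hw : Tendsto (fun R : ℝ => R / (2 * Real.pi)) atTop (cocompact ℝ) :=
    (tendsto_id.atTop_div_const (by positivity)).mono_right atTop_le_cocompact
  have h := (Complex.continuous_im.tendsto _).comp
    ((Real.tendsto_integral_exp_smul_cocompact fun x => (K x : ℂ)).comp hw)
  rw [Complex.zero_im] at h
  rw [← neg_zero]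
  refine Tendsto.congr (fun R => ?_) h.neg
  have he (x : ℝ) : Real.fourierChar (-(x * (R / (2 * Real.pi)))) • (K x : ℂ) =
      Complex.exp ((-(R * x) : ℝ) * Complex.I) * K x := by
    rw [Circle.smul_def, Real.fourierChar_apply, smul_eq_mul]
    congr 3
    push_cast
    field_simp
  have hi : Integrable fun x : ℝ => Complex.exp ((-(R * x) : ℝ) * Complex.I) * (K x : ℂ) :=
    hK.ofReal.bdd_mul (c := 1) (by fun_prop)
      (.of_forall fun x => (Complex.norm_exp_ofReal_mul_I _).le)
  have h3 := Complex.imCLM.integral_comp_comm hi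
  simp only [Complex.imCLM_apply, Complex.im_mul_ofReal, Complex.exp_ofReal_mul_I_im,
    Real.sin_neg, neg_mul, integral_neg] at h3
  simp only [Function.comp_apply, he]
  rw [← h3, neg_neg]

lemma MeasureTheory.Integrable.sin_smul {d : ℕ} {K : ℝ → E d} (hK : Integrable K) (R : ℝ) :
    Integrable fun x => Real.sin (R * x) • K x :=
  hK.bdd_smul (φ := fun x => Real.sin (R * x)) 1
    (by fun_prop) (.of_forall fun x => by simpa using Real.abs_sin_le_one _)

lemma MeasureTheory.Integrable.cos_smul {d : ℕ} {K : ℝ → E d} (hK : Integrable K) (R : ℝ) :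
    Integrable fun x => Real.cos (R * x) • K x :=
  hK.bdd_smul (φ := fun x => Real.cos (R * x)) 1
    (by fun_prop) (.of_forall fun x => by simpa using Real.abs_cos_le_one _)

/-- The Riemann-Lebesgue lemma for sine transforms of vector-valued functions. -/
lemma tendsto_integral_sin_smul {d : ℕ} {K : ℝ → E d} (hK : Integrable K) :
    Tendsto (fun R : ℝ => ∫ x, Real.sin (R * x) • K x) atTop (𝓝 0) := by
  have hcoord (i : Fin d) : Tendsto (fun R : ℝ => (∫ x, Real.sin (R * x) • K x) i) atTop (𝓝 0) := by
    refine Tendsto.congr (fun R => ?_)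
      (tendsto_integral_sin_mul ((EuclideanSpace.proj (𝕜 := ℝ) i).integrable_comp hK))
    have h := (EuclideanSpace.proj (𝕜 := ℝ) i).integral_comp_comm (hK.sin_smul R)
    simpa using h
  have h := (PiLp.continuous_toLp 2 fun _ : Fin d => ℝ).tendsto 0 |>.comp
    (tendsto_pi_nhds.2 hcoord)
  simpa [Function.comp_def] using h

lemma integral_cos_mul_exp_neg_sq (r : ℝ) :
    ∫ x : ℝ, Real.cos (r * x) * Real.exp (-x ^ 2) = √Real.pi * Real.exp (-(1 / 4) * r ^ 2) := by
  have h := fourierIntegral_gaussian (b := 1) (by simp) (r : ℂ)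
  have hi : Integrable fun x : ℝ => Complex.exp (Complex.I * r * x) * Complex.exp (-1 * x ^ 2) := by
    have := integrable_cexp_quadratic (b := 1) (by simp) (Complex.I * r) 0
    refine this.congr (.of_forall fun x => ?_)
    simp only [← Complex.exp_add]
    congr 1; ring
  have h2 := congrArg Complex.re h
  have h3 := Complex.reCLM.integral_comp_comm hi
  simp only [Complex.reCLM_apply] at h3
  rw [← h3] at h2
  have e1 (x : ℝ) : (Complex.exp (Complex.I * r * x) * Complex.exp (-1 * x ^ 2)).re =
      Real.cos (r * x) * Real.exp (-x ^ 2) := by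
    have : Complex.exp (-1 * x ^ 2) = ((Real.exp (-x ^ 2) : ℝ) : ℂ) := by push_cast; ring_nf
    rw [this, Complex.re_mul_ofReal, show Complex.I * r * x = ((r * x : ℝ) : ℂ) * Complex.I by
      push_cast; ring, Complex.exp_ofReal_mul_I_re]
  simp only [e1] at h2
  rw [h2]
  have e2 : ((Real.pi : ℂ) / 1) ^ (1 / 2 : ℂ) * Complex.exp (-(r : ℂ) ^ 2 / (4 * 1)) =
      ((√Real.pi * Real.exp (-(1 / 4) * r ^ 2) : ℝ) : ℂ) := by
    rw [div_one, Real.sqrt_eq_rpow, Complex.ofReal_mul, Complex.ofReal_cpow Real.pi_pos.le]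
    push_cast
    ring_nf
  rw [e2, Complex.ofReal_re]

lemma tendsto_integral_integral_cos_mul_exp_neg_sq :
    Tendsto (fun R : ℝ => ∫ r in (0 : ℝ)..R, ∫ x : ℝ, Real.cos (r * x) * Real.exp (-x ^ 2))
      atTop (𝓝 Real.pi) := by
  simp only [integral_cos_mul_exp_neg_sq]
  have hi : Integrable fun r : ℝ => √Real.pi * Real.exp (-(1 / 4) * r ^ 2) :=
    (integrable_exp_neg_mul_sq (by norm_num)).const_mul _
  have h := intervalIntegral_tendsto_integral_Ioi 0 hi.integrableOn tendsto_id
  convert h using 1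
  · rfl
  congr 1
  rw [integral_const_mul, integral_gaussian_Ioi,
    show Real.pi / (1 / 4) = Real.pi * 2 ^ 2 by ring,
    Real.sqrt_mul Real.pi_pos.le, Real.sqrt_sq (by norm_num)]
  have := Real.mul_self_sqrt Real.pi_pos.le
  linarith

lemma integral_integral_cos_smul {d : ℕ} {D : ℝ → E d} (hD : Integrable D) (R : ℝ) :
    ∫ r in (0 : ℝ)..R, ∫ x, Real.cos (r * x) • D x = ∫ x, Real.sin (R * x) • x⁻¹ • D x := by
  rw [intervalIntegral_integral_swap]
  · refine integral_congr_ae ?_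
    filter_upwards [compl_mem_ae_iff.2 (measure_singleton (0 : ℝ))] with x hx
    have hx : x ≠ 0 := hx
    rw [intervalIntegral.integral_smul_const, smul_smul]
    congr 1
    rw [intervalIntegral.integral_comp_mul_right (f := Real.cos) hx, integral_cos]
    simp [mul_comm]
  · have : IsFiniteMeasure (volume.restrict (Set.uIoc 0 R)) := ⟨by simp [Set.uIoc]⟩
    have h1 : Integrable (fun p : ℝ × ℝ => D p.2)
        ((volume.restrict (Set.uIoc 0 R)).prod volume) := hD.comp_snd _
    exact h1.bdd_smul (φ := fun p : ℝ × ℝ => Real.cos (p.1 * p.2)) 1 (by fun_prop)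
      (.of_forall fun p => by simpa using Real.abs_cos_le_one _)

/-- A function vanishing linearly at the origin stays integrable after division by the variable. -/
lemma MeasureTheory.Integrable.inv_smul_of_norm_le {d : ℕ} {D : ℝ → E d} (hD : Integrable D) {C δ : ℝ}
    (hδ : 0 < δ) (hC : ∀ x, |x| < δ → ‖D x‖ ≤ C * |x|) : Integrable fun x => x⁻¹ • D x := by
  have hdom : Integrable fun x : ℝ => (Set.Ioo (-δ) δ).indicator (fun _ => |C|) x + δ⁻¹ * ‖D x‖ :=
    ((integrable_indicator_iff measurableSet_Ioo).2 (by simp)).add (hD.norm.const_mul _)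
  refine hdom.mono' ((by fun_prop : AEStronglyMeasurable fun x : ℝ => x⁻¹).smul hD.1)
    (.of_forall fun x => ?_)
  rw [norm_smul, norm_inv, Real.norm_eq_abs]
  have hn : 0 ≤ δ⁻¹ * ‖D x‖ := by positivity
  by_cases hx : |x| < δ
  · rw [Set.indicator_of_mem (show x ∈ Set.Ioo (-δ) δ from abs_lt.1 hx)]
    have : |x|⁻¹ * ‖D x‖ ≤ |C| := by
      rcases eq_or_ne x 0 with rfl | h0
      · simp
      · rw [inv_mul_le_iff₀ (abs_pos.2 h0), mul_comm]
        exact (hC x hx).trans (by gcongr; exact le_abs_self C)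
    linarith
  · rw [Set.indicator_of_notMem (show x ∉ Set.Ioo (-δ) δ from fun h => hx (abs_lt.2 h)), zero_add]
    gcongr
    exact not_lt.1 hx

/-- Pointwise Fourier inversion for the cosine transform, at a point where the function satisfies a
Lipschitz condition. -/
lemma tendsto_integral_integral_cos_smul {d : ℕ} {H : ℝ → E d} (hH : Integrable H) {C δ : ℝ}
    (hδ : 0 < δ) (hC : ∀ x, |x| < δ → ‖H x - H 0‖ ≤ C * |x|) :
    Tendsto (fun R : ℝ => ∫ r in (0 : ℝ)..R, ∫ x, Real.cos (r * x) • H x) atTop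
      (𝓝 (Real.pi • H 0)) := by
  have hg : Integrable fun x : ℝ => Real.exp (-x ^ 2) := by
    simpa using integrable_exp_neg_mul_sq (b := 1) one_pos
  have hgH : Integrable fun x : ℝ => Real.exp (-x ^ 2) • H 0 := hg.smul_const _
  set D : ℝ → E d := fun x => H x - Real.exp (-x ^ 2) • H 0 with hDdef
  have hD : Integrable D := hH.sub hgH
  have hDle (x : ℝ) (hx : |x| < min δ 1) : ‖D x‖ ≤ (C + ‖H 0‖) * |x| := by
    have h1 : D x = (H x - H 0) + (1 - Real.exp (-x ^ 2)) • H 0 := by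
      simp only [hDdef, sub_smul, one_smul]; abel
    have h2 : |1 - Real.exp (-x ^ 2)| ≤ |x| := by
      rw [abs_of_nonneg (sub_nonneg.2 (Real.exp_le_one_iff.2 (by nlinarith [sq_nonneg x])))]
      have h3 := Real.add_one_le_exp (-x ^ 2)
      have h4 : |x| ^ 2 ≤ |x| * 1 := by
        rw [sq]; gcongr; exact (hx.trans_le (min_le_right _ _)).le
      rw [sq_abs] at h4
      linarith
    rw [h1]
    refine (norm_add_le _ _).trans ?_
    rw [norm_smul, Real.norm_eq_abs, add_mul, mul_comm ‖H 0‖]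
    exact add_le_add (hC x (hx.trans_le (min_le_left _ _))) (by gcongr)
  have hK := hD.inv_smul_of_norm_le (lt_min hδ one_pos) hDle
  have hlim := (tendsto_integral_sin_smul hK).add
    (tendsto_integral_integral_cos_mul_exp_neg_sq.smul_const (H 0))
  rw [zero_add] at hlim
  refine hlim.congr fun R => ?_
  rw [← integral_integral_cos_smul hD, ← intervalIntegral.integral_smul_const,
    ← intervalIntegral.integral_add]
  · refine intervalIntegral.integral_congr fun r _ => ?_
    beta_reduce
    rw [← integral_smul_const, ← integral_add (hD.cos_smul r)]
    · refine integral_congr_ae (.of_forall fun x => ?_)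
      simp only [hDdef, smul_sub, smul_smul, sub_add_cancel]
    · simpa only [smul_smul] using hgH.cos_smul r
  · refine Continuous.intervalIntegrable ?_ _ _
    exact continuous_of_dominated (bound := fun x => ‖D x‖)
      (fun r => (hD.cos_smul r).1)
      (fun r => .of_forall fun x => by
        rw [norm_smul]
        exact mul_le_of_le_one_left (norm_nonneg _) (by simpa using Real.abs_cos_le_one _))
      hD.norm (.of_forall fun x => by fun_prop)
  · simp only [integral_cos_mul_exp_neg_sq]
    exact Continuous.intervalIntegrable (by fun_prop) _ _

lemma integrable_sphere_prod {d : ℕ} {F : E d → E d} (hF : Integrable F) :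
    Integrable (fun p : Metric.sphere (0 : E d) 1 × Set.Ioi (0 : ℝ) => F (p.2.1 • p.1.1))
      ((volume : Measure (E d)).toSphere.prod (.volumeIoiPow (d - 1))) := by
  have h := (volume : Measure (E d)).measurePreserving_homeomorphUnitSphereProd.integrable_comp_emb
    (Homeomorph.measurableEmbedding _)
    (g := fun p : Metric.sphere (0 : E d) 1 × Set.Ioi (0 : ℝ) => F (p.2.1 • p.1.1))
  rw [finrank_euclideanSpace_fin] at h
  rw [← h]
  have h2 : (fun p : Metric.sphere (0 : E d) 1 × Set.Ioi (0 : ℝ) => F (p.2.1 • p.1.1)) ∘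
      homeomorphUnitSphereProd (E d) = F ∘ Subtype.val := by
    ext1 x
    simp only [Function.comp_apply]
    rw [← homeomorphUnitSphereProd_symm_apply_coe, Homeomorph.symm_apply_apply]
  rw [h2, ← integrableOn_iff_comap_subtypeVal (measurableSet_singleton _).compl]
  exact hF.integrableOn

/-- The radial profile of an integrable function is integrable. -/
lemma integrableOn_pow_smul_integral_sphere {d : ℕ} {F : E d → E d} (hF : Integrable F) :
    IntegrableOn (fun ρ : ℝ => ρ ^ (d - 1) • ∫ ω : Metric.sphere (0 : E d) 1, F (ρ • ω.1)
      ∂(volume : Measure (E d)).toSphere) (Set.Ioi 0) := by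
  have h := (integrable_sphere_prod hF).integral_prod_right
  rw [Measure.volumeIoiPow, integrable_withDensity_iff_integrable_smul' (by fun_prop) (by simp)] at h
  rw [integrableOn_iff_comap_subtypeVal measurableSet_Ioi]
  refine h.congr (.of_forall fun ρ => ?_)
  simp only [Function.comp_apply, ENNReal.toReal_ofReal (pow_nonneg (le_of_lt ρ.2) (d - 1))]

/-- Integration in polar coordinates. -/
lemma integral_eq_integral_sphere {d : ℕ} [Nontrivial (E d)] {F : E d → E d} (hF : Integrable F) :
    ∫ x, F x = ∫ ρ in Set.Ioi (0 : ℝ), ρ ^ (d - 1) • ∫ ω : Metric.sphere (0 : E d) 1, F (ρ • ω.1)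
      ∂(volume : Measure (E d)).toSphere := by
  have h := (volume : Measure (E d)).measurePreserving_homeomorphUnitSphereProd.integral_comp
    (Homeomorph.measurableEmbedding _)
    (fun p : Metric.sphere (0 : E d) 1 × Set.Ioi (0 : ℝ) => F (p.2.1 • p.1.1))
  rw [finrank_euclideanSpace_fin, integral_prod_symm _ (integrable_sphere_prod hF)] at h
  simp only [← homeomorphUnitSphereProd_symm_apply_coe,
    Homeomorph.symm_apply_apply] at h
  rw [integral_subtype_comap (measurableSet_singleton _).compl, restrict_compl_singleton] at h
  rw [h, Measure.volumeIoiPow]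
  simp only [ENNReal.ofReal]
  rw [integral_withDensity_eq_integral_smul (by fun_prop),
    ← integral_subtype_comap measurableSet_Ioi fun ρ : ℝ => ρ ^ (d - 1) •
      ∫ ω : Metric.sphere (0 : E d) 1, F (ρ • ω.1) ∂(volume : Measure (E d)).toSphere]
  refine integral_congr_ae (.of_forall fun ρ => ?_)
  beta_reduce
  rw [NNReal.smul_def, Real.coe_toNNReal _ (pow_nonneg (le_of_lt ρ.2) _)]

lemma contDiff_gfun {d : ℕ} (f : SchwartzMap (E d) ℂ) : ContDiff ℝ 1 (gfun f) :=
  ((f.smooth 1).norm_sq ℝ).smul contDiff_id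

lemma integrable_gfun {d : ℕ} (f : SchwartzMap (E d) ℂ) : Integrable (gfun f) := by
  obtain ⟨C, hC⟩ := f.decay 0 0
  refine ((f.integrable_pow_mul volume 1).const_mul C).mono'
    (contDiff_gfun f).continuous.aestronglyMeasurable (.of_forall fun x => ?_)
  have h := hC.2 x
  simp only [pow_zero, one_mul, norm_iteratedFDeriv_zero] at h
  rw [gfun, norm_smul, norm_pow, norm_norm, pow_one]
  calc ‖f x‖ ^ 2 * ‖x‖ = ‖f x‖ * (‖x‖ * ‖f x‖) := by ring
    _ ≤ C * (‖x‖ * ‖f x‖) := by gcongr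

/-- The integral of `gfun f` over the sphere of centre `u` and radius `ρ`, up to a factor `ρ`. -/
def sphereInt {d : ℕ} (f : SchwartzMap (E d) ℂ) (u : E d) (ρ : ℝ) : E d :=
  ∫ ω : Metric.sphere (0 : E d) 1, ρ ^ (d - 2) • gfun f (u + ρ • ω.1)
    ∂(volume : Measure (E d)).toSphere

/-- `sphereInt` is jointly Lipschitz in the centre and the radius on bounded sets. -/
lemma exists_norm_sphereInt_sub_le {d : ℕ} (f : SchwartzMap (E d) ℂ) (M : ℝ) :
    ∃ L : ℝ, 0 ≤ L ∧ ∀ (u v : E d) (ρ σ : ℝ), ‖u‖ ≤ M → ‖v‖ ≤ M → |ρ| ≤ M → |σ| ≤ M →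
      ‖sphereInt f u ρ - sphereInt f v σ‖ ≤ L * max ‖u - v‖ |ρ - σ| := by
  set W : E d × ℝ × E d → E d := fun p => p.2.1 ^ (d - 2) • gfun f (p.1 + p.2.1 • p.2.2) with hW
  have hWc : ContDiff ℝ 1 W :=
    (contDiff_snd.fst.pow _).smul ((contDiff_gfun f).comp
      (contDiff_fst.add (contDiff_snd.fst.smul contDiff_snd.snd)))
  obtain ⟨K, hK⟩ := hWc.contDiffOn.exists_lipschitzOnWith one_ne_zero
    (convex_closedBall 0 (max M 1)) (isCompact_closedBall 0 (max M 1))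
  set τ := (volume : Measure (E d)).toSphere
  have hint (u : E d) (ρ : ℝ) : Integrable
      (fun ω : Metric.sphere (0 : E d) 1 => ρ ^ (d - 2) • gfun f (u + ρ • ω.1)) τ := by
    have hc : Continuous fun ω : Metric.sphere (0 : E d) 1 => W (u, ρ, ω.1) :=
      hWc.continuous.comp (by fun_prop)
    exact hc.integrable_of_hasCompactSupport (.of_compactSpace _)
  refine ⟨K * τ.real univ, by positivity, fun u v ρ σ hu hv hρ hσ => ?_⟩
  rw [sphereInt, sphereInt, ← integral_sub (hint u ρ) (hint v σ)]
  refine (norm_integral_le_of_norm_le_const (C := K * max ‖u - v‖ |ρ - σ|)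
    (.of_forall fun ω => ?_)).trans (le_of_eq (by ring))
  have hmem {w : E d} {t : ℝ} (hw : ‖w‖ ≤ M) (ht : |t| ≤ M) :
      (w, t, ω.1) ∈ Metric.closedBall (0 : E d × ℝ × E d) (max M 1) := by
    simp only [mem_closedBall_zero_iff, Prod.norm_def, norm_eq_of_mem_sphere, Real.norm_eq_abs]
    exact max_le (hw.trans (le_max_left _ _)) (max_le (ht.trans (le_max_left _ _)) (le_max_right _ _))
  have h := hK.norm_sub_le (hmem hu hρ) (hmem hv hσ)
  simpa [hW, Prod.norm_def] using h

/-- The velocity field of the limit equation, as an integral over a sphere. -/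
def sphereField {d : ℕ} (f : SchwartzMap (E d) ℂ) (u : E d) : E d :=
  -Real.pi • sphereInt f u ‖u‖

lemma exists_lipschitzOnWith_sphereField {d : ℕ} (f : SchwartzMap (E d) ℂ) (M : ℝ) :
    ∃ K : NNReal, LipschitzOnWith K (sphereField f) (Metric.closedBall 0 M) := by
  obtain ⟨L, hL, h⟩ := exists_norm_sphereInt_sub_le f M
  refine ⟨(Real.pi * L).toNNReal, LipschitzOnWith.of_dist_le_mul fun u hu v hv => ?_⟩
  rw [mem_closedBall_zero_iff] at hu hv
  rw [dist_eq_norm, dist_eq_norm, sphereField, sphereField, ← smul_sub, norm_smul, norm_neg,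
    Real.norm_eq_abs, abs_of_pos Real.pi_pos, Real.coe_toNNReal _ (by positivity), mul_assoc]
  gcongr
  refine (h u v _ _ hu hv (by simpa) (by simpa)).trans (le_of_eq ?_)
  rw [max_eq_left (abs_norm_sub_norm_le u v)]

/-- The profile whose cosine transform is `F0inner`, as a function of the squared radius. -/
def radialProfile {d : ℕ} (f : SchwartzMap (E d) ℂ) (u : E d) : ℝ → E d :=
  (Set.Ioi 0).indicator fun s => (1 / 2 : ℝ) • sphereInt f u (√s)

lemma pow_smul_integral_sphere {d : ℕ} (hd : 2 ≤ d) (f : SchwartzMap (E d) ℂ) (u : E d) {ρ : ℝ}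
    (hρ : 0 < ρ) :
    ρ ^ (d - 1) • ∫ ω : Metric.sphere (0 : E d) 1, gfun f (u + ρ • ω.1)
      ∂(volume : Measure (E d)).toSphere = (2 * ρ) • radialProfile f u (ρ ^ 2) := by
  rw [radialProfile, Set.indicator_of_mem (Set.mem_Ioi.2 (by positivity)),
    Real.sqrt_sq hρ.le, sphereInt, integral_smul, smul_smul, smul_smul,
    show d - 1 = d - 2 + 1 by omega, pow_succ]
  congr 1
  ring

lemma integrable_radialProfile {d : ℕ} (hd : 2 ≤ d) (f : SchwartzMap (E d) ℂ) (u : E d) :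
    Integrable (radialProfile f u) := by
  have h0 : IntegrableOn (radialProfile f u) (Set.Ioi 0) := by
    rw [← integrableOn_Ioi_comp_rpow_iff _ two_ne_zero]
    refine (integrableOn_pow_smul_integral_sphere ((integrable_gfun f).comp_add_left u)).congr_fun
      (fun ρ hρ => ?_) measurableSet_Ioi
    beta_reduce
    rw [pow_smul_integral_sphere hd f u hρ, Real.rpow_two]
    norm_num
  rw [radialProfile, integrable_indicator_iff measurableSet_Ioi]
  exact h0.congr_fun (fun s hs => Set.indicator_of_mem hs _) measurableSet_Ioi

lemma F0inner_eq {d : ℕ} (hd : 2 ≤ d) (f : SchwartzMap (E d) ℂ) (r : ℝ) (u : E d) :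
    F0inner f r u = ∫ x, Real.cos (r * x) • radialProfile f u (‖u‖ ^ 2 + x) := by
  have : Nontrivial (Fin d) := Fin.nontrivial_iff_two_le.2 hd
  have : Nontrivial (E d) := inferInstance
  have hphase (ζ : E d) : ‖u + ζ‖ ^ 2 - 2 * ⟪u + ζ, u⟫ = ‖ζ‖ ^ 2 - ‖u‖ ^ 2 := by
    rw [norm_add_sq_real, inner_add_left, real_inner_self_eq_norm_sq, real_inner_comm]
    ring
  rw [F0inner, ← integral_add_left_eq_self _ u]
  simp only [hphase]
  rw [integral_eq_integral_sphere]
  · have h2 : ∫ x, Real.cos (r * x) • radialProfile f u (‖u‖ ^ 2 + x) =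
        ∫ s in Set.Ioi 0, Real.cos (r * (s - ‖u‖ ^ 2)) • radialProfile f u s := by
      rw [← integral_add_left_eq_self _ (-‖u‖ ^ 2), ← integral_indicator measurableSet_Ioi]
      refine integral_congr_ae (.of_forall fun s => ?_)
      by_cases hs : s ∈ Set.Ioi (0 : ℝ)
      · simp [hs, neg_add_eq_sub]
      · simp [hs, radialProfile]
    rw [h2, ← integral_comp_rpow_Ioi
      (fun s => Real.cos (r * (s - ‖u‖ ^ 2)) • radialProfile f u s) two_ne_zero]
    refine setIntegral_congr_fun measurableSet_Ioi fun ρ hρ => ?_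
    have hω (ω : Metric.sphere (0 : E d) 1) : ‖ρ • ω.1‖ = ρ := by
      simp [norm_smul, abs_of_pos hρ.out]
    simp only [hω]
    rw [integral_smul, smul_comm, pow_smul_integral_sphere hd f u hρ, Real.rpow_two, smul_comm]
    norm_num
  · exact ((integrable_gfun f).comp_add_left u).bdd_smul
      (φ := fun ζ : E d => Real.cos (r * (‖ζ‖ ^ 2 - ‖u‖ ^ 2))) 1
      (by fun_prop) (.of_forall fun x => by simpa using Real.abs_cos_le_one _)

lemma exists_norm_radialProfile_sub_le {d : ℕ} (f : SchwartzMap (E d) ℂ) {u : E d} (hu : u ≠ 0) :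
    ∃ C : ℝ, ∀ x, |x| < ‖u‖ ^ 2 →
      ‖radialProfile f u (‖u‖ ^ 2 + x) - radialProfile f u (‖u‖ ^ 2 + 0)‖ ≤ C * |x| := by
  obtain ⟨L, hL, h⟩ := exists_norm_sphereInt_sub_le f (2 * ‖u‖)
  have hu0 : 0 < ‖u‖ := norm_pos_iff.2 hu
  refine ⟨1 / 2 * (L * ‖u‖⁻¹), fun x hx => ?_⟩
  have hx' := abs_lt.1 hx
  have hpos : 0 < ‖u‖ ^ 2 + x := by linarith
  have hsq := Real.sq_sqrt hpos.le
  have hs0 := Real.sqrt_nonneg (‖u‖ ^ 2 + x)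
  rw [add_zero, radialProfile, Set.indicator_of_mem (Set.mem_Ioi.2 hpos),
    Set.indicator_of_mem (Set.mem_Ioi.2 (by positivity)), Real.sqrt_sq hu0.le,
    ← smul_sub, norm_smul, Real.norm_of_nonneg (by norm_num), mul_assoc]
  gcongr
  have hle : √(‖u‖ ^ 2 + x) ≤ 2 * ‖u‖ := by
    apply Real.sqrt_le_iff.2
    constructor <;> nlinarith
  refine (h u u _ _ (by linarith) (by linarith) (by rwa [abs_of_nonneg hs0])
    (by rw [abs_norm]; linarith)).trans ?_
  rw [sub_self, norm_zero, max_eq_right (abs_nonneg _), mul_assoc]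
  gcongr
  have hx2 : x = (√(‖u‖ ^ 2 + x) - ‖u‖) * (√(‖u‖ ^ 2 + x) + ‖u‖) := by linarith
  have habs : |x| = |√(‖u‖ ^ 2 + x) - ‖u‖| * (√(‖u‖ ^ 2 + x) + ‖u‖) := by
    conv_lhs => rw [hx2]
    rw [abs_mul, abs_of_pos (by linarith : 0 < √(‖u‖ ^ 2 + x) + ‖u‖)]
  rw [le_inv_mul_iff₀ hu0, habs, mul_comm]
  gcongr
  linarith

/-- Away from the origin, the improper integral `F0pt` converges to an integral over a sphere. -/
lemma F0pt_eq_sphereField {d : ℕ} (hd : 2 ≤ d) (f : SchwartzMap (E d) ℂ) {u : E d} (hu : u ≠ 0) :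
    F0pt f u = sphereField f u := by
  obtain ⟨C, hC⟩ := exists_norm_radialProfile_sub_le f hu
  have hpos : 0 < ‖u‖ ^ 2 := by positivity
  have h := tendsto_integral_integral_cos_smul
    ((integrable_radialProfile hd f u).comp_add_left (‖u‖ ^ 2)) hpos hC
  refine Tendsto.limUnder_eq ?_
  simp only [intervalIntegral.integral_smul, F0inner_eq hd]
  convert h.const_smul (-2 : ℝ) using 2
  rw [sphereField, radialProfile, add_zero, Set.indicator_of_mem (Set.mem_Ioi.2 hpos),
    Real.sqrt_sq (norm_nonneg u), smul_smul, smul_smul]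
  congr 1
  ring

section MaximalSolution

variable {X : Type*} [NormedAddCommGroup X] [NormedSpace ℝ X] {V : X → X}

/-- `ζ` solves `ζ' = V ∘ ζ` on `[0, T)` with initial value `x₀` and values in `U`. -/
def IsSolutionOn (V : X → X) (U : Set X) (x₀ : X) (T : ℝ) (ζ : ℝ → X) : Prop :=
  ζ 0 = x₀ ∧ ∀ t ∈ Set.Ico 0 T, ζ t ∈ U ∧ HasDerivWithinAt ζ (V (ζ t)) (Set.Ici 0) t

lemma IsSolutionOn.eq {U : Set X} {x₀ : X} {T₁ T₂ : ℝ} {ζ₁ ζ₂ : ℝ → X}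
    (hV : ∀ M, ∃ K, LipschitzOnWith K V (Metric.closedBall 0 M))
    (h₁ : IsSolutionOn V U x₀ T₁ ζ₁) (h₂ : IsSolutionOn V U x₀ T₂ ζ₂) {t : ℝ} (ht : 0 ≤ t)
    (ht₁ : t < T₁) (ht₂ : t < T₂) : ζ₁ t = ζ₂ t := by
  have hc {T : ℝ} {ζ : ℝ → X} (h : IsSolutionOn V U x₀ T ζ) (htT : t < T) :
      ContinuousOn ζ (Set.Icc 0 t) := fun s hs =>
    (h.2 s ⟨hs.1, hs.2.trans_lt htT⟩).2.continuousWithinAt.mono Set.Icc_subset_Ici_self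
  obtain ⟨M₁, hM₁⟩ := isCompact_Icc.exists_bound_of_continuousOn (hc h₁ ht₁)
  obtain ⟨M₂, hM₂⟩ := isCompact_Icc.exists_bound_of_continuousOn (hc h₂ ht₂)
  obtain ⟨K, hK⟩ := hV (max M₁ M₂)
  refine ODE_solution_unique_of_mem_Icc_right (v := fun _ => V)
    (s := fun _ => Metric.closedBall 0 (max M₁ M₂)) (fun _ _ => hK) (hc h₁ ht₁)
    (fun s hs => (h₁.2 s ⟨hs.1, hs.2.trans ht₁⟩).2.mono (Set.Ici_subset_Ici.2 hs.1)) (fun s hs => ?_)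
    (hc h₂ ht₂)
    (fun s hs => (h₂.2 s ⟨hs.1, hs.2.trans ht₂⟩).2.mono (Set.Ici_subset_Ici.2 hs.1)) (fun s hs => ?_)
    (h₁.1.trans h₂.1.symm) ⟨ht, le_rfl⟩
  · exact mem_closedBall_zero_iff.2 ((hM₁ s (Set.Ico_subset_Icc_self hs)).trans (le_max_left _ _))
  · exact mem_closedBall_zero_iff.2 ((hM₂ s (Set.Ico_subset_Icc_self hs)).trans (le_max_right _ _))

lemma exists_isSolutionOn [CompleteSpace X]
    (hV : ∀ M, ∃ K, LipschitzOnWith K V (Metric.closedBall 0 M)) {U : Set X} (hU : IsOpen U)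
    {x₀ : X} (hx₀ : x₀ ∈ U) : ∃ T > 0, ∃ ζ, IsSolutionOn V U x₀ T ζ := by
  obtain ⟨K, hK⟩ := hV (‖x₀‖ + 1)
  have hK' : LipschitzOnWith K V (Metric.closedBall x₀ (1 : NNReal)) :=
    hK.mono fun x hx => by
      rw [mem_closedBall_zero_iff]
      rw [mem_closedBall_iff_norm, NNReal.coe_one] at hx
      linarith [norm_le_norm_add_norm_sub x₀ x, norm_sub_rev x₀ x]
  set L : NNReal := ‖V x₀‖₊ + K + 1
  have hb : ∀ x ∈ Metric.closedBall x₀ (1 : NNReal), ‖V x‖ ≤ L := fun x hx => by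
    have h1 := hK'.norm_sub_le hx (Metric.mem_closedBall_self zero_le_one)
    rw [mem_closedBall_iff_norm, NNReal.coe_one] at hx
    have h2 : (K : ℝ) * ‖x - x₀‖ ≤ K := mul_le_of_le_one_right K.2 hx
    have h3 := norm_le_norm_add_norm_sub (V x₀) (V x)
    simp only [L, NNReal.coe_add, coe_nnnorm, NNReal.coe_one]
    linarith [norm_sub_rev (V x₀) (V x)]
  have hL : (0 : ℝ) < L := by positivity
  have hε : (0 : ℝ) < (L : ℝ)⁻¹ := inv_pos.2 hL
  have hpl : IsPicardLindelof (fun _ => V) (tmin := 0) (tmax := (L : ℝ)⁻¹)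
      ⟨0, Set.left_mem_Icc.2 hε.le⟩ x₀ 1 0 L K :=
    .of_time_independent hb hK' (by simp [hL.ne', hε.le])
  obtain ⟨ζ, hζ0, hζ⟩ := hpl.exists_eq_forall_mem_Icc_hasDerivWithinAt₀
  have hζ0' : ζ 0 = x₀ := hζ0
  have hcont : ContinuousWithinAt ζ (Set.Icc 0 (L : ℝ)⁻¹) 0 :=
    (hζ 0 (Set.left_mem_Icc.2 hε.le)).continuousWithinAt
  have hev := hcont.eventually (hU.mem_nhds (hζ0'.symm ▸ hx₀))
  obtain ⟨δ, hδ, hδU⟩ := Metric.mem_nhdsWithin_iff.1 hev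
  refine ⟨min δ (L : ℝ)⁻¹, lt_min hδ hε, ζ, hζ0', fun t ht => ?_⟩
  have ht1 := ht.2.trans_le (min_le_left _ _)
  have ht2 := ht.2.trans_le (min_le_right _ _)
  refine ⟨hδU ⟨by simpa [abs_of_nonneg ht.1] using ht1, ht.1, ht2.le⟩, ?_⟩
  refine (hζ t ⟨ht.1, ht2.le⟩).mono_of_mem_nhdsWithin ?_
  rw [← Set.Ici_inter_Iic]
  exact Filter.inter_mem self_mem_nhdsWithin (mem_nhdsWithin_of_mem_nhds (Iic_mem_nhds ht2))

/-- Existence and uniqueness of the maximal forward solution of an autonomous equation whose vector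
field is Lipschitz on bounded sets, among solutions with values in an open set. -/
lemma exists_maximal_isSolutionOn [CompleteSpace X]
    (hV : ∀ M, ∃ K, LipschitzOnWith K V (Metric.closedBall 0 M)) {U : Set X} (hU : IsOpen U)
    {x₀ : X} (hx₀ : x₀ ∈ U) :
    ∃ (Tmax : ℝ≥0∞) (ξ : ℝ → X), 0 < Tmax ∧ ξ 0 = x₀ ∧
      (∀ t : ℝ, 0 ≤ t → ENNReal.ofReal t < Tmax →
        ξ t ∈ U ∧ HasDerivWithinAt ξ (V (ξ t)) (Set.Ici 0) t) ∧
      ∀ (T : ℝ) (ζ : ℝ → X), IsSolutionOn V U x₀ T ζ →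
        ENNReal.ofReal T ≤ Tmax ∧ ∀ t ∈ Set.Ico 0 T, ζ t = ξ t := by
  classical
  let ξ : ℝ → X := fun t =>
    if h : ∃ T, t < T ∧ ∃ ζ, IsSolutionOn V U x₀ T ζ then h.choose_spec.2.choose t else x₀
  have hξ {T : ℝ} {ζ : ℝ → X} (h : IsSolutionOn V U x₀ T ζ) (t : ℝ) (ht : t ∈ Set.Ico 0 T) :
      ζ t = ξ t := by
    have hex : ∃ T, t < T ∧ ∃ ζ, IsSolutionOn V U x₀ T ζ := ⟨T, ht.2, ζ, h⟩
    simp only [ξ, dif_pos hex]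
    exact h.eq hV hex.choose_spec.2.choose_spec ht.1 ht.2 hex.choose_spec.1
  obtain ⟨T₀, hT₀, ζ₀, hζ₀⟩ := exists_isSolutionOn hV hU hx₀
  refine ⟨⨆ (T : ℝ) (_ : ∃ ζ, IsSolutionOn V U x₀ T ζ), ENNReal.ofReal T, ξ, ?_, ?_, ?_, ?_⟩
  · exact (ENNReal.ofReal_pos.2 hT₀).trans_le (le_iSup₂_of_le T₀ ⟨ζ₀, hζ₀⟩ le_rfl)
  · rw [← hξ hζ₀ 0 ⟨le_rfl, hT₀⟩, hζ₀.1]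
  · intro t ht htT
    obtain ⟨T, hT⟩ := lt_iSup_iff.1 htT
    obtain ⟨⟨ζ, hζ⟩, hlt⟩ := lt_iSup_iff.1 hT
    have htT := (ENNReal.ofReal_lt_ofReal_iff_of_nonneg ht).1 hlt
    obtain ⟨hmem, hder⟩ := hζ.2 t ⟨ht, htT⟩
    rw [← hξ hζ t ⟨ht, htT⟩]
    refine ⟨hmem, hder.congr_of_eventuallyEq ?_ (hξ hζ t ⟨ht, htT⟩).symm⟩
    filter_upwards [self_mem_nhdsWithin, mem_nhdsWithin_of_mem_nhds (Iio_mem_nhds htT)] with s hs hsT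
    exact (hξ hζ s ⟨hs, hsT⟩).symm
  · exact fun T ζ h => ⟨le_iSup₂_of_le T ⟨ζ, h⟩ le_rfl, hξ h⟩

end MaximalSolution

/-- for `d ≥ 3`, `f` Schwartz, `ξ₀ ≠ 0`, the equation
`(d/dt) ξ^(0) = F^(0)(ξ^(0))`, `ξ^(0)(0) = ξ₀` has a unique maximal solution
`ξ^(0) ∈ C¹([0,T_max); ℝ^d \ {0})` with `T_max > 0`: there are `T_max` and a solution `ξ` on
`[0, T_max)` such that every solution on some `[0,T')` satisfies `T' ≤ T_max` and agrees
with `ξ` on `[0,T')`. -/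
theorem statement9 (d : ℕ) (hd : 3 ≤ d) (f : SchwartzMap (E d) ℂ) (ξ₀ : E d) (hξ₀ : ξ₀ ≠ 0) :
    ∃ (Tmax : ℝ≥0∞) (ξ : ℝ → E d), 0 < Tmax ∧ ξ 0 = ξ₀ ∧
      (∀ t : ℝ, 0 ≤ t → ENNReal.ofReal t < Tmax →
        ξ t ≠ 0 ∧ HasDerivWithinAt ξ (F0pt f (ξ t)) (Set.Ici (0 : ℝ)) t) ∧
      ∀ (T' : ℝ) (ζ : ℝ → E d), 0 < T' → ζ 0 = ξ₀ →
        (∀ t ∈ Set.Ico (0 : ℝ) T',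
          ζ t ≠ 0 ∧ HasDerivWithinAt ζ (F0pt f (ζ t)) (Set.Ici (0 : ℝ)) t) →
        ENNReal.ofReal T' ≤ Tmax ∧ ∀ t ∈ Set.Ico (0 : ℝ) T', ζ t = ξ t := by

  have hF {x : E d} (hx : x ≠ 0) : F0pt f x = sphereField f x :=
    F0pt_eq_sphereField (le_trans (by norm_num) hd) f hx
  obtain ⟨Tmax, ξ, hT, h0, hsol, hmax⟩ := exists_maximal_isSolutionOn
    (exists_lipschitzOnWith_sphereField f) isOpen_compl_singleton
    (Set.mem_compl_singleton_iff.2 hξ₀)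
  refine ⟨Tmax, ξ, hT, h0, fun t ht htT => ?_, fun T' ζ _ hζ0 hζ => ?_⟩
  · obtain ⟨hne, hder⟩ := hsol t ht htT
    exact ⟨hne, (hF hne).symm ▸ hder⟩
  · exact hmax T' ζ ⟨hζ0, fun t ht => ⟨(hζ t ht).1, hF (hζ t ht).1 ▸ (hζ t ht).2⟩⟩
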